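/- For every constant k < M and every x ∈ G, the map of LIP-additive Asplund distances is invariant under LIP-adding k to the image: Asp_b(f ⊞ k)(x) = Asp_b(f)(x), where (f ⊞ k)(y) = f(y) ⊞ k pointwise (note f(y) ⊞ k < M for all y, so Asp_b(f ⊞ k) is defined). -/

import Mathlib

/-- LIP-addition: a ⊞ b = a + b - a·b/M. -/
noncomputable def lipAdd (M a b : ℝ) : ℝ := a + b - a * b / M

/-- LIP-difference (defined when b < M): a ⊟ b = M·(a - b)/(M - b). -/
noncomputable def lipSub (M a b : ℝ) : ℝ := M * (a - b) / (M - b)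

/-- LIP-erosion of f by a structuring function a with support Da:
ε_a(f)(x) = min_{h ∈ Da} ( f(x+h) ⊟ a(h) ). -/
noncomputable def lipErosion (M : ℝ) {G : Type*} [AddCommGroup G]
    (Da : Finset G) (hne : Da.Nonempty) (a f : G → ℝ) (x : G) : ℝ :=
  Da.inf' hne fun h => lipSub M (f (x + h)) (a h)

/-- LIP-dilation of f by a structuring function a with support Da:
δ_a(f)(x) = max_{h ∈ Da} ( f(x−h) ⊞ a(h) ). -/
noncomputable def lipDilation (M : ℝ) {G : Type*} [AddCommGroup G]
    (Da : Finset G) (hne : Da.Nonempty) (a f : G → ℝ) (x : G) : ℝ :=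
  Da.sup' hne fun h => lipAdd M (f (x - h)) (a h)

theorem lipAdd_lt {M a k : ℝ} (hM : 0 < M) (ha : a < M) (hk : k < M) : lipAdd M a k < M := by
  have h : M - lipAdd M a k = (M - a) * (M - k) / M := by
    unfold lipAdd
    field_simp
    ring
  have : 0 < (M - a) * (M - k) / M :=
    div_pos (mul_pos (sub_pos.2 ha) (sub_pos.2 hk)) hM
  linarith

theorem lipAdd_eq (M a k : ℝ) : lipAdd M a k = a * (1 - k / M) + k := by
  unfold lipAdd
  ring

theorem one_sub_div_pos_of_lt {M k : ℝ} (hM : 0 < M) (hk : k < M) : 0 < 1 - k / M :=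
  sub_pos.2 ((div_lt_one hM).2 hk)

theorem monotone_lipAdd_right {M k : ℝ} (hM : 0 < M) (hk : k < M) :
    Monotone fun a => lipAdd M a k := by
  intro a c hac
  simp only [lipAdd_eq]
  gcongr
  exact (one_sub_div_pos_of_lt hM hk).le

theorem lipSub_lipAdd {M b : ℝ} (hM : 0 < M) (hb : b < M) (a k : ℝ) :
    lipSub M (lipAdd M a k) b = lipAdd M (lipSub M a b) k := by
  have : M - b ≠ 0 := (sub_pos.2 hb).ne'
  unfold lipSub lipAdd
  field_simp
  ring

theorem lipSub_lipAdd_lipAdd {M k : ℝ} (hM : 0 < M) (hk : k < M) (a c : ℝ) :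
    lipSub M (lipAdd M a k) (lipAdd M c k) = lipSub M a c := by
  have hnum : M * (lipAdd M a k - lipAdd M c k) = M * (a - c) * (1 - k / M) := by
    simp only [lipAdd_eq]
    ring
  have hden : M - lipAdd M c k = (M - c) * (1 - k / M) := by
    unfold lipAdd
    field_simp
    ring
  rw [lipSub, hnum, hden, mul_div_mul_right _ _ (one_sub_div_pos_of_lt hM hk).ne', lipSub]

/-- the map of LIP-additive Asplund distances,
Asp_b(f)(x) = c1_b(f)(x) ⊟ c2_b(f)(x) with
c1_b(f)(x) = max_{h ∈ Db} ( f(x+h) ⊟ b(h) ) and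
c2_b(f)(x) = min_{h ∈ Db} ( f(x+h) ⊟ b(h) ),
is invariant under LIP-adding a constant k < M to the image. -/
theorem aspMap_lipAdd_const (M : ℝ) (hM : 0 < M) {G : Type*} [AddCommGroup G]
    (Db : Finset G) (hne : Db.Nonempty) (b : G → ℝ) (hb : ∀ h ∈ Db, b h < M)
    (f : G → ℝ) (hf : ∀ x, f x < M) (k : ℝ) (hk : k < M) (x : G) :
    let Asp : (G → ℝ) → G → ℝ := fun g y =>
      lipSub M (Db.sup' hne fun h => lipSub M (g (y + h)) (b h))
        (Db.inf' hne fun h => lipSub M (g (y + h)) (b h))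
    (∀ y : G, lipAdd M (f y) k < M) ∧
    Asp (fun y => lipAdd M (f y) k) x = Asp f x := by
  intro Asp
  refine ⟨fun y => lipAdd_lt hM (hf y) hk, ?_⟩
  have hmono := monotone_lipAdd_right hM hk
  have hsub : ∀ h ∈ Db, lipSub M (lipAdd M (f (x + h)) k) (b h) =
      lipAdd M (lipSub M (f (x + h)) (b h)) k :=
    fun h hh => lipSub_lipAdd hM (hb h hh) _ _
  have hsup : (Db.sup' hne fun h => lipSub M (lipAdd M (f (x + h)) k) (b h)) =
      lipAdd M (Db.sup' hne fun h => lipSub M (f (x + h)) (b h)) k :=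
    (Finset.sup'_congr hne rfl hsub).trans
      (Finset.apply_sup'_eq_sup'_comp hne (fun a => lipAdd M a k) hmono.map_sup).symm
  have hinf : (Db.inf' hne fun h => lipSub M (lipAdd M (f (x + h)) k) (b h)) =
      lipAdd M (Db.inf' hne fun h => lipSub M (f (x + h)) (b h)) k :=
    (Finset.inf'_congr hne rfl hsub).trans
      (Finset.apply_inf'_eq_inf'_comp hne (fun a => lipAdd M a k) hmono.map_inf).symm
  simp only [Asp, hsup, hinf, lipSub_lipAdd_lipAdd hM hk]
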